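/- Let D be a proper subdomain of a Banach space that is δ-Gromov hyperbolic in the quasihyperbolic metric, and let x₁, x₂ ∈ D. Then for any two c₀-quasigeodesics ϑ, γ in D with endpoints x₁ and x₂, one has max{ℓ(ϑ), ℓ(γ)} ≤ 4e^{8c₀²μ₂} · min{ℓ(ϑ), ℓ(γ)}, where μ₂ = μ₂(δ, c₀) is the constant from the stability of quasigeodesics in Gromov hyperbolic spaces. -/

import Mathlib

open Set Metric MeasureTheory

noncomputable section

variable {E : Type*} [NormedAddCommGroup E]

/-- Distance from a point to the boundary (= complement) of `D`. -/
def dB (D : Set E) (z : E) : ℝ := Metric.infDist z Dᶜ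

/-- `D` is a proper subdomain of the ambient space. -/
def IsProperDomain (D : Set E) : Prop := IsOpen D ∧ IsConnected D ∧ Dᶜ.Nonempty

/-- A rectifiable arc inside `D`, parametrized by arclength on `[a,b]`. -/
structure IsArc (D : Set E) (γ : ℝ → E) (a b : ℝ) : Prop where
  le : a ≤ b
  lip : LipschitzOnWith 1 γ (Set.Icc a b)
  unit : ∀ s t, s ∈ Set.Icc a b → t ∈ Set.Icc a b → s ≤ t →
    eVariationOn γ (Set.Icc s t) = ENNReal.ofReal (t - s)
  mem : ∀ t ∈ Set.Icc a b, γ t ∈ D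

/-- Quasihyperbolic length of the piece on `[a,b]` of an arclength-parametrized arc. -/
def qhLen (D : Set E) (γ : ℝ → E) (a b : ℝ) : ℝ := ∫ t in a..b, 1 / dB D (γ t)

/-- The quasihyperbolic distance in `D`: infimum of quasihyperbolic lengths of
arcs joining the two points. -/
def qhDist (D : Set E) (x y : E) : ℝ :=
  sInf { L : ℝ | ∃ T : ℝ, ∃ γ : ℝ → E,
    IsArc D γ 0 T ∧ γ 0 = x ∧ γ T = y ∧ L = qhLen D γ 0 T }

/-- `γ` is a `c`-quasigeodesic in `D` on `[a,b]`. -/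
def IsQuasigeodesicOn (D : Set E) (c : ℝ) (γ : ℝ → E) (a b : ℝ) : Prop :=
  IsArc D γ a b ∧ ∀ s t, s ∈ Set.Icc a b → t ∈ Set.Icc a b → s ≤ t →
    qhLen D γ s t ≤ c * qhDist D (γ s) (γ t)

/-- The coefficient `c_{x,y}^λ = min (1 + λ/(2 k_D(x,y))) (9/8)`. -/
def cLam (D : Set E) (lam : ℝ) (x y : E) : ℝ :=
  min (1 + lam / (2 * qhDist D x y)) (9 / 8)

/-- `γ` is a `λ`-curve in `D` on `[a,b]`: a `c_{x,y}^λ`-quasigeodesic where `x,y`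
are its endpoints. -/
def IsLamCurve (D : Set E) (lam : ℝ) (γ : ℝ → E) (a b : ℝ) : Prop :=
  IsQuasigeodesicOn D (cLam D lam (γ a) (γ b)) γ a b

/-- `γ` is `h`-short in `D`. -/
def IsShort (D : Set E) (h : ℝ) (γ : ℝ → E) (a b : ℝ) : Prop :=
  IsArc D γ a b ∧ ∀ s t, s ∈ Set.Icc a b → t ∈ Set.Icc a b → s ≤ t →
    qhLen D γ s t ≤ qhDist D (γ s) (γ t) + h

/-- The point `w` lies within quasihyperbolic distance `C` of the union of the
two given sides. -/
def WithinOfSides (D : Set E) (C : ℝ) (w : E) (α : ℝ → E) (a b : ℝ)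
    (α' : ℝ → E) (a' b' : ℝ) : Prop :=
  ∃ s : ℝ, (s ∈ Set.Icc a b ∧ qhDist D w (α s) ≤ C) ∨
    (s ∈ Set.Icc a' b' ∧ qhDist D w (α' s) ≤ C)

/-- `(D, k_D)` is a `(C,h)`-Rips space: every side of an `h`-short triangle lies
in the `C`-neighbourhood of the two other sides. -/
def IsRips (D : Set E) (C h : ℝ) : Prop :=
  ∀ (α₁ α₂ α₃ : ℝ → E) (a₁ b₁ a₂ b₂ a₃ b₃ : ℝ),
    IsShort D h α₁ a₁ b₁ → IsShort D h α₂ a₂ b₂ → IsShort D h α₃ a₃ b₃ →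
    α₁ b₁ = α₂ a₂ → α₂ b₂ = α₃ a₃ → α₃ b₃ = α₁ a₁ →
    (∀ t ∈ Set.Icc a₁ b₁, WithinOfSides D C (α₁ t) α₂ a₂ b₂ α₃ a₃ b₃) ∧
    (∀ t ∈ Set.Icc a₂ b₂, WithinOfSides D C (α₂ t) α₃ a₃ b₃ α₁ a₁ b₁) ∧
    (∀ t ∈ Set.Icc a₃ b₃, WithinOfSides D C (α₃ t) α₁ a₁ b₁ α₂ a₂ b₂)

/-- `D` is `δ`-Gromov hyperbolic with respect to the quasihyperbolic metric. -/
def IsGromovHyp (D : Set E) (δ : ℝ) : Prop :=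
  ∀ x ∈ D, ∀ y ∈ D, ∀ z ∈ D, ∀ p ∈ D,
    min ((qhDist D p x + qhDist D p y - qhDist D x y) / 2)
        ((qhDist D p y + qhDist D p z - qhDist D y z) / 2) - δ ≤
      (qhDist D p x + qhDist D p z - qhDist D x z) / 2

/-- `μ` is a thin-triangles constant for triangles of `c₀`-quasigeodesics in `D`. -/
def ThinTriangles (D : Set E) (c₀ μ : ℝ) : Prop :=
  ∀ (γ₁ γ₂ γ₃ : ℝ → E) (a₁ b₁ a₂ b₂ a₃ b₃ : ℝ),
    IsQuasigeodesicOn D c₀ γ₁ a₁ b₁ → IsQuasigeodesicOn D c₀ γ₂ a₂ b₂ →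
    IsQuasigeodesicOn D c₀ γ₃ a₃ b₃ →
    γ₁ b₁ = γ₂ a₂ → γ₂ b₂ = γ₃ a₃ → γ₃ b₃ = γ₁ a₁ →
    ∀ t ∈ Set.Icc a₁ b₁, WithinOfSides D μ (γ₁ t) γ₂ a₂ b₂ γ₃ a₃ b₃

/-- `D` is a `c`-uniform domain. -/
def IsUniform (D : Set E) (c : ℝ) : Prop :=
  ∀ z₁ ∈ D, ∀ z₂ ∈ D, ∃ γ : ℝ → E, ∃ a b : ℝ, IsArc D γ a b ∧ γ a = z₁ ∧ γ b = z₂ ∧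
    (∀ t ∈ Set.Icc a b, min (t - a) (b - t) ≤ c * dB D (γ t)) ∧
    b - a ≤ c * ‖z₁ - z₂‖

/-- `D` is an `a`-John domain. -/
def IsJohn (D : Set E) (a : ℝ) : Prop :=
  ∀ z₁ ∈ D, ∀ z₂ ∈ D, ∃ γ : ℝ → E, ∃ s t : ℝ, IsArc D γ s t ∧ γ s = z₁ ∧ γ t = z₂ ∧
    ∀ u ∈ Set.Icc s t, min (u - s) (t - u) ≤ a * dB D (γ u)

/-- The inner (length) distance in `D`. -/
def innerDist (D : Set E) (x y : E) : ℝ :=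
  sInf { L : ℝ | ∃ γ : ℝ → E, ∃ s t : ℝ, IsArc D γ s t ∧ γ s = x ∧ γ t = y ∧ L = t - s }

/-- `γ` is an inner `b`-uniform curve in `D`. -/
def IsInnerUniformCurve (D : Set E) (b : ℝ) (γ : ℝ → E) (s t : ℝ) : Prop :=
  (∀ u ∈ Set.Icc s t, min (u - s) (t - u) ≤ b * dB D (γ u)) ∧
  t - s ≤ b * innerDist D (γ s) (γ t)

/-- `D` is an inner `b`-uniform domain. -/
def IsInnerUniform (D : Set E) (b : ℝ) : Prop :=
  ∀ z₁ ∈ D, ∀ z₂ ∈ D, ∃ γ : ℝ → E, ∃ s t : ℝ,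
    IsArc D γ s t ∧ γ s = z₁ ∧ γ t = z₂ ∧ IsInnerUniformCurve D b γ s t

/-- Length (total variation) of a curve on `[a,b]`. -/
def lenOn {F : Type*} [NormedAddCommGroup F] (γ : ℝ → F) (a b : ℝ) : ℝ :=
  (eVariationOn γ (Set.Icc a b)).toReal

variable {F : Type*} [NormedAddCommGroup F]

/-- `f` is a homeomorphism from `D` onto `D'`. -/
def IsHomeoOn (f : E → F) (D : Set E) (D' : Set F) : Prop :=
  ∃ g : F → E, ContinuousOn f D ∧ ContinuousOn g D' ∧ Set.MapsTo f D D' ∧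
    Set.MapsTo g D' D ∧ (∀ x ∈ D, g (f x) = x) ∧ (∀ y ∈ D', f (g y) = y)

/-- `f : D → D'` is `(M,C)`-coarsely quasihyperbolic. -/
def IsCQH (f : E → F) (D : Set E) (D' : Set F) (M C : ℝ) : Prop :=
  ∀ x ∈ D, ∀ y ∈ D,
    (qhDist D x y - C) / M ≤ qhDist D' (f x) (f y) ∧
    qhDist D' (f x) (f y) ≤ M * qhDist D x y + C

section Basic

variable {D : Set E} {γ : ℝ → E} {a b : ℝ} {x y z : E}

lemma dB_pos (hD : IsProperDomain D) (hz : z ∈ D) : 0 < dB D z :=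
  (hD.1.isClosed_compl.notMem_iff_infDist_pos hD.2.2).1 (by simpa using hz)

lemma dB_le_add_norm (D : Set E) (x y : E) : dB D y ≤ dB D x + ‖x - y‖ := by
  have h := Metric.infDist_le_infDist_add_dist (s := Dᶜ) (x := y) (y := x)
  rwa [dist_comm, dist_eq_norm] at h

lemma continuous_dB (D : Set E) : Continuous (dB D) :=
  Metric.continuous_infDist_pt _

lemma IsArc.hasUnitSpeedOn (h : IsArc D γ a b) : HasUnitSpeedOn γ (Icc a b) := by
  refine hasConstantSpeedOnWith_iff_ordered.2 fun s hs t ht hst => ?_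
  rw [inter_eq_self_of_subset_right (Icc_subset_Icc hs.1 ht.2), h.unit s t hs ht hst]
  simp

lemma IsArc.of_hasUnitSpeedOn (hab : a ≤ b) (h : HasUnitSpeedOn γ (Icc a b))
    (hmem : ∀ t ∈ Icc a b, γ t ∈ D) : IsArc D γ a b := by
  have hunit : ∀ s t, s ∈ Icc a b → t ∈ Icc a b → s ≤ t →
      eVariationOn γ (Icc s t) = ENNReal.ofReal (t - s) := by
    intro s t hs ht hst
    have h' := h hs ht
    rw [inter_eq_self_of_subset_right (Icc_subset_Icc hs.1 ht.2)] at h'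
    simpa using h'
  refine ⟨hab, ?_, hunit, hmem⟩
  have key : ∀ s ∈ Icc a b, ∀ t ∈ Icc a b, s ≤ t → edist (γ s) (γ t) ≤ edist s t := by
    intro s hs t ht hst
    refine (eVariationOn.edist_le γ (left_mem_Icc.2 hst) (right_mem_Icc.2 hst)).trans ?_
    rw [hunit s t hs ht hst, edist_dist, dist_comm, Real.dist_eq, abs_of_nonneg (by linarith)]
  intro s hs t ht
  simp only [ENNReal.coe_one, one_mul]
  rcases le_total s t with hst | hst
  · exact key s hs t ht hst
  · rw [edist_comm, edist_comm s t]
    exact key t ht s hs hst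

lemma IsArc.continuousOn (h : IsArc D γ a b) : ContinuousOn γ (Icc a b) :=
  h.lip.continuousOn

lemma IsArc.norm_sub_le (h : IsArc D γ a b) : ‖γ a - γ b‖ ≤ b - a := by
  have h' := h.lip.dist_le_mul a (left_mem_Icc.2 h.le) b (right_mem_Icc.2 h.le)
  rw [dist_comm a b, Real.dist_eq, abs_of_nonneg (by linarith [h.le]), dist_eq_norm] at h'
  simpa using h'

lemma IsArc.mono {s t : ℝ} (h : IsArc D γ a b) (hs : a ≤ s) (hst : s ≤ t) (ht : t ≤ b) :
    IsArc D γ s t where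
  le := hst
  lip := h.lip.mono (Icc_subset_Icc hs ht)
  unit u v hu hv := h.unit u v (Icc_subset_Icc hs ht hu) (Icc_subset_Icc hs ht hv)
  mem u hu := h.mem u (Icc_subset_Icc hs ht hu)

lemma IsArc.congr {γ' : ℝ → E} (h : IsArc D γ a b) (he : EqOn γ γ' (Icc a b)) :
    IsArc D γ' a b where
  le := h.le
  lip := fun s hs t ht => by rw [← he hs, ← he ht]; exact h.lip hs ht
  unit s t hs ht hst := by
    rw [← h.unit s t hs ht hst]
    exact (eVariationOn.eq_of_eqOn (he.mono (Icc_subset_Icc hs.1 ht.2))).symm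
  mem t ht := he ht ▸ h.mem t ht

lemma IsArc.comp_add (h : IsArc D γ a b) (c : ℝ) :
    IsArc D (fun t => γ (t + c)) (a - c) (b - c) := by
  refine .of_hasUnitSpeedOn (by linarith [h.le]) ?_ fun t ht => h.mem _ ⟨?_, ?_⟩
  · refine hasConstantSpeedOnWith_iff_ordered.2 fun s hs t ht hst => ?_
    rw [inter_eq_self_of_subset_right (Icc_subset_Icc hs.1 ht.2)]
    have h1 := eVariationOn.comp_eq_of_monotoneOn γ (fun u : ℝ => u + c) (t := Icc s t)
      (fun u _ v _ huv => by simpa using huv)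
    rw [image_add_const_Icc, h.unit _ _ ⟨by linarith [hs.1], by linarith [hs.2]⟩
      ⟨by linarith [ht.1], by linarith [ht.2]⟩ (by linarith)] at h1
    simpa [Function.comp_def] using h1
  · linarith [ht.1]
  · linarith [ht.2]

lemma IsArc.comp_neg (h : IsArc D γ a b) : IsArc D (fun t => γ (-t)) (-b) (-a) := by
  refine .of_hasUnitSpeedOn (by linarith [h.le]) ?_ fun t ht => h.mem _ ⟨?_, ?_⟩
  · refine hasConstantSpeedOnWith_iff_ordered.2 fun s hs t ht hst => ?_
    rw [inter_eq_self_of_subset_right (Icc_subset_Icc hs.1 ht.2)]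
    have h1 := eVariationOn.comp_eq_of_antitoneOn γ (fun u : ℝ => -u) (t := Icc s t)
      (fun u _ v _ huv => by simpa using huv)
    rw [show (fun u : ℝ => -u) '' Icc s t = Icc (-t) (-s) by simp,
      h.unit _ _ ⟨by linarith [ht.2], by linarith [ht.1]⟩
      ⟨by linarith [hs.2], by linarith [hs.1]⟩ (by linarith)] at h1
    simpa [Function.comp_def, add_comm, sub_eq_add_neg] using h1
  · linarith [ht.2]
  · linarith [ht.1]

lemma isArc_const (hx : x ∈ D) (a : ℝ) : IsArc D (fun _ => x) a a := by
  refine .of_hasUnitSpeedOn le_rfl ?_ fun _ _ => hx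
  rw [Icc_self]
  exact hasConstantSpeedOnWith_of_subsingleton _ subsingleton_singleton _

lemma IsArc.continuousOn_density (hD : IsProperDomain D) (h : IsArc D γ a b) :
    ContinuousOn (fun t => 1 / dB D (γ t)) (Icc a b) :=
  continuousOn_const.div ((continuous_dB D).comp_continuousOn h.continuousOn)
    fun t ht => (dB_pos hD (h.mem t ht)).ne'

lemma IsArc.intervalIntegrable (hD : IsProperDomain D) (h : IsArc D γ a b) :
    IntervalIntegrable (fun t => 1 / dB D (γ t)) volume a b :=
  (h.continuousOn_density hD).intervalIntegrable_of_Icc h.le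

lemma qhLen_nonneg (D : Set E) (γ : ℝ → E) (hab : a ≤ b) : 0 ≤ qhLen D γ a b :=
  intervalIntegral.integral_nonneg hab fun _ _ => one_div_nonneg.2 Metric.infDist_nonneg

lemma IsArc.qhLen_add (hD : IsProperDomain D) (h : IsArc D γ a b) {c : ℝ} (hc : c ∈ Icc a b) :
    qhLen D γ a c + qhLen D γ c b = qhLen D γ a b :=
  intervalIntegral.integral_add_adjacent_intervals
    ((h.mono le_rfl hc.1 hc.2).intervalIntegrable hD)
    ((h.mono hc.1 hc.2 le_rfl).intervalIntegrable hD)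

lemma qhLen_comp_add (D : Set E) (γ : ℝ → E) (a b c : ℝ) :
    qhLen D (fun t => γ (t + c)) (a - c) (b - c) = qhLen D γ a b := by
  simp [qhLen, intervalIntegral.integral_comp_add_right (fun t => (dB D (γ t))⁻¹)]

lemma qhLen_comp_neg (D : Set E) (γ : ℝ → E) (a b : ℝ) :
    qhLen D (fun t => γ (-t)) (-b) (-a) = qhLen D γ a b := by
  simp [qhLen, intervalIntegral.integral_comp_neg (fun t => (dB D (γ t))⁻¹)]

lemma qhLen_congr {γ' : ℝ → E} (hab : a ≤ b) (he : EqOn γ γ' (Icc a b)) :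
    qhLen D γ a b = qhLen D γ' a b := by
  refine intervalIntegral.integral_congr fun t ht => ?_
  rw [uIcc_of_le hab] at ht
  simp only [he ht]

/-- Growth of the boundary distance along an arc of given quasihyperbolic length. -/
lemma IsArc.dB_add_le (hD : IsProperDomain D) (h : IsArc D γ a b) :
    dB D (γ a) + ‖γ a - γ b‖ ≤ dB D (γ a) * Real.exp (qhLen D γ a b) := by
  have hd := dB_pos hD (h.mem a (left_mem_Icc.2 h.le))
  have hab := h.le
  set d := dB D (γ a)
  have hint : ∫ t in a..b, 1 / (d + (t - a)) = Real.log ((d + (b - a)) / d) := by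
    have h1 : ∀ t : ℝ, 1 / (d + (t - a)) = 1 / (t + (d - a)) := fun t => by
      congr 1; ring
    simp only [h1]
    rw [intervalIntegral.integral_comp_add_right (fun t => 1 / t),
      integral_one_div_of_pos (by linarith) (by linarith)]
    congr 1; congr 1 <;> ring
  have hle : Real.log ((d + (b - a)) / d) ≤ qhLen D γ a b := by
    rw [← hint]
    refine intervalIntegral.integral_mono_on hab ?_ (h.intervalIntegrable hD) fun t ht => ?_
    · refine ContinuousOn.intervalIntegrable_of_Icc hab (continuousOn_const.div (by fun_prop) ?_)
      intro t ht
      linarith [ht.1]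
    · refine one_div_le_one_div_of_le (dB_pos hD (h.mem t ht)) ?_
      have := (h.mono le_rfl ht.1 ht.2).norm_sub_le
      linarith [dB_le_add_norm D (γ a) (γ t)]
  have h2 := Real.exp_le_exp.2 hle
  rw [Real.exp_log (by positivity), div_le_iff₀ hd] at h2
  linarith [h.norm_sub_le]

/-- `x` and `y` are joined by an arc in `D`. -/
def ArcJoined (D : Set E) (x y : E) : Prop :=
  ∃ T : ℝ, ∃ γ : ℝ → E, IsArc D γ 0 T ∧ γ 0 = x ∧ γ T = y

lemma qhDist_bddBelow (D : Set E) (x y : E) : BddBelow { L : ℝ | ∃ T : ℝ, ∃ γ : ℝ → E,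
    IsArc D γ 0 T ∧ γ 0 = x ∧ γ T = y ∧ L = qhLen D γ 0 T } :=
  ⟨0, by rintro _ ⟨T, γ, h, -, -, rfl⟩; exact qhLen_nonneg D γ h.le⟩

lemma qhDist_nonneg (D : Set E) (x y : E) : 0 ≤ qhDist D x y :=
  Real.sInf_nonneg (by rintro _ ⟨T, γ, h, -, -, rfl⟩; exact qhLen_nonneg D γ h.le)

lemma IsArc.arcJoined (h : IsArc D γ a b) : ArcJoined D (γ a) (γ b) :=
  ⟨b - a, fun t => γ (t + a), by simpa using h.comp_add a, by simp, by simp⟩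

lemma IsArc.qhDist_le (h : IsArc D γ a b) : qhDist D (γ a) (γ b) ≤ qhLen D γ a b :=
  csInf_le (qhDist_bddBelow _ _ _) ⟨b - a, fun t => γ (t + a), by simpa using h.comp_add a,
    by simp, by simp, by simpa using (qhLen_comp_add D γ a b a).symm⟩

lemma ArcJoined.le_qhDist {m : ℝ} (h : ArcJoined D x y)
    (H : ∀ T : ℝ, ∀ γ : ℝ → E, IsArc D γ 0 T → γ 0 = x → γ T = y → m ≤ qhLen D γ 0 T) :
    m ≤ qhDist D x y := by
  obtain ⟨T, γ, h1, h2, h3⟩ := h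
  refine le_csInf ⟨_, T, γ, h1, h2, h3, rfl⟩ ?_
  rintro _ ⟨T, γ, h1, h2, h3, rfl⟩
  exact H T γ h1 h2 h3

lemma ArcJoined.symm (h : ArcJoined D x y) : ArcJoined D y x := by
  obtain ⟨T, γ, h, rfl, rfl⟩ := h
  simpa using h.comp_neg.arcJoined

lemma IsArc.exists_append {γ' : ℝ → E} {a' b' : ℝ} (hD : IsProperDomain D) (h : IsArc D γ a b)
    (h' : IsArc D γ' a' b') (hb : γ b = γ' a') : ∃ (σ : ℝ → E) (c : ℝ), IsArc D σ a c ∧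
      σ a = γ a ∧ σ c = γ' b' ∧ qhLen D σ a c = qhLen D γ a b + qhLen D γ' a' b' := by
  have g := h'.comp_add (a' - b)
  have gl := qhLen_comp_add D γ' a' b' (a' - b)
  rw [show a' - (a' - b) = b by ring] at g gl
  have hle := g.le
  set σ : ℝ → E := fun t => if t ≤ b then γ t else γ' (t + (a' - b))
  have e1 : EqOn γ σ (Icc a b) := fun t ht => by simp [σ, ht.2]
  have e2 : EqOn (fun t => γ' (t + (a' - b))) σ (Icc b (b' - (a' - b))) := fun t ht => by
    rcases ht.1.eq_or_lt with rfl | hlt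
    · simp [σ, hb]
    · simp [σ, not_le.2 hlt]
  have g1 := h.congr e1
  have g2 := g.congr e2
  have hσ : IsArc D σ a (b' - (a' - b)) := by
    refine .of_hasUnitSpeedOn (h.le.trans hle)
      (g1.hasUnitSpeedOn.Icc_Icc g2.hasUnitSpeedOn) fun t ht => ?_
    rcases le_total t b with htb | htb
    · exact g1.mem t ⟨ht.1, htb⟩
    · exact g2.mem t ⟨htb, ht.2⟩
  refine ⟨σ, _, hσ, (e1 (left_mem_Icc.2 h.le)).symm, ?_, ?_⟩
  · refine (e2 (right_mem_Icc.2 hle)).symm.trans ?_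
    simp
  · rw [← hσ.qhLen_add hD ⟨h.le, hle⟩, ← qhLen_congr h.le e1, ← qhLen_congr hle e2, gl]

lemma ArcJoined.trans (hD : IsProperDomain D) (h : ArcJoined D x y) (h' : ArcJoined D y z) :
    ArcJoined D x z := by
  obtain ⟨T, γ, h, rfl, rfl⟩ := h
  obtain ⟨T', γ', h', h0, rfl⟩ := h'
  obtain ⟨σ, c, hσ, e1, e2, -⟩ := h.exists_append hD h' h0.symm
  rw [← e1, ← e2]
  exact hσ.arcJoined

lemma qhDist_triangle (hD : IsProperDomain D) (h : ArcJoined D x y) (h' : ArcJoined D y z) :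
    qhDist D x z ≤ qhDist D x y + qhDist D y z := by
  suffices qhDist D x z - qhDist D y z ≤ qhDist D x y by linarith
  refine h.le_qhDist fun T γ hγ e1 e2 => ?_
  suffices qhDist D x z - qhLen D γ 0 T ≤ qhDist D y z by linarith
  refine h'.le_qhDist fun T' γ' hγ' e1' e2' => ?_
  obtain ⟨σ, c, hσ, f1, f2, hl⟩ := hγ.exists_append hD hγ' (e2.trans e1'.symm)
  have := hσ.qhDist_le
  rw [f1, f2, e1, e2', hl] at this
  linarith

lemma ArcJoined.qhDist_le_symm (h : ArcJoined D x y) : qhDist D y x ≤ qhDist D x y := by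
  refine h.le_qhDist fun T γ hγ e1 e2 => ?_
  have := hγ.comp_neg.qhDist_le
  rw [qhLen_comp_neg] at this
  simpa [e1, e2] using this

lemma ArcJoined.qhDist_comm (h : ArcJoined D x y) : qhDist D x y = qhDist D y x :=
  le_antisymm h.symm.qhDist_le_symm h.qhDist_le_symm

lemma qhDist_self (hx : x ∈ D) : qhDist D x x = 0 := by
  refine le_antisymm ?_ (qhDist_nonneg _ _ _)
  simpa [qhLen] using (isArc_const hx 0).qhDist_le

lemma ArcJoined.dB_add_le (hD : IsProperDomain D) (h : ArcJoined D x y) :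
    dB D x + ‖x - y‖ ≤ dB D x * Real.exp (qhDist D x y) := by
  have hx : 0 < dB D x := by
    obtain ⟨T, γ, h, rfl, -⟩ := h
    exact dB_pos hD (h.mem 0 (left_mem_Icc.2 h.le))
  have hpos : 0 < (dB D x + ‖x - y‖) / dB D x := by positivity
  have : Real.log ((dB D x + ‖x - y‖) / dB D x) ≤ qhDist D x y := by
    refine h.le_qhDist fun T γ hγ e1 e2 => ?_
    rw [Real.log_le_iff_le_exp hpos, div_le_iff₀ hx, mul_comm]
    simpa [e1, e2] using hγ.dB_add_le hD
  rwa [Real.log_le_iff_le_exp hpos, div_le_iff₀ hx, mul_comm] at this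

lemma ArcJoined.dB_le (hD : IsProperDomain D) (h : ArcJoined D x y) :
    dB D y ≤ dB D x * Real.exp (qhDist D x y) :=
  (dB_le_add_norm D x y).trans (h.dB_add_le hD)

lemma IsArc.arcJoined_of_mem (h : IsArc D γ a b) {s t : ℝ} (hs : s ∈ Icc a b)
    (ht : t ∈ Icc a b) : ArcJoined D (γ s) (γ t) := by
  rcases le_total s t with hst | hst
  · exact (h.mono hs.1 hst ht.2).arcJoined
  · exact (h.mono ht.1 hst hs.2).arcJoined.symm

lemma IsQuasigeodesicOn.comp_neg {c : ℝ} (h : IsQuasigeodesicOn D c γ a b) :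
    IsQuasigeodesicOn D c (fun t => γ (-t)) (-b) (-a) := by
  refine ⟨h.1.comp_neg, fun s t hs ht hst => ?_⟩
  have hs' : -s ∈ Icc a b := ⟨by linarith [hs.2], by linarith [hs.1]⟩
  have ht' : -t ∈ Icc a b := ⟨by linarith [ht.2], by linarith [ht.1]⟩
  have h1 := h.2 (-t) (-s) ht' hs' (by linarith)
  rw [(h.1.arcJoined_of_mem ht' hs').qhDist_comm] at h1
  have h2 := qhLen_comp_neg D γ (-t) (-s)
  rw [neg_neg, neg_neg] at h2
  rwa [h2]

lemma isQuasigeodesicOn_const {c : ℝ} (hc : 0 ≤ c) (hx : x ∈ D) (a : ℝ) :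
    IsQuasigeodesicOn D c (fun _ => x) a a := by
  refine ⟨isArc_const hx a, fun s t hs ht hst => ?_⟩
  rw [Icc_self, mem_singleton_iff] at hs ht
  subst hs ht
  simpa [qhLen] using mul_nonneg hc (qhDist_nonneg D x x)

/-- Two quasigeodesics with common endpoints stay close to each other. -/
lemma ThinTriangles.exists_near {c μ : ℝ} (hc : 0 ≤ c) (hthin : ThinTriangles D c μ)
    {ϑ : ℝ → E} {a' b' : ℝ} (hϑ : IsQuasigeodesicOn D c ϑ a b)
    (hγ : IsQuasigeodesicOn D c γ a' b') (h1 : ϑ a = γ a') (h2 : ϑ b = γ b') {t : ℝ}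
    (ht : t ∈ Icc a b) : ∃ s ∈ Icc a' b', qhDist D (ϑ t) (γ s) ≤ μ := by
  have hb' : b' ∈ Icc a' b' := right_mem_Icc.2 hγ.1.le
  obtain ⟨s, ⟨-, hd⟩ | ⟨hs, hd⟩⟩ := hthin ϑ (fun _ => γ b') (fun t => γ (-t)) a b 0 0 (-b') (-a')
    hϑ (isQuasigeodesicOn_const hc (hγ.1.mem _ hb') 0) hγ.comp_neg h2 (by simp) (by simp [h1]) t ht
  · exact ⟨b', hb', hd⟩
  · exact ⟨-s, ⟨by linarith [hs.2], by linarith [hs.1]⟩, hd⟩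

end Basic

section Comparison

lemma lintegral_Icc_eq_ofReal {f : ℝ → ℝ} {s t : ℝ} (hst : s ≤ t)
    (hf : ContinuousOn f (Icc s t)) (hf0 : ∀ u ∈ Icc s t, 0 ≤ f u) :
    ∫⁻ u in Icc s t, ENNReal.ofReal (f u) = ENNReal.ofReal (∫ u in s..t, f u) := by
  rw [intervalIntegral.integral_of_le hst, ← integral_Icc_eq_integral_Ioc,
    ofReal_integral_eq_lintegral_ofReal (hf.integrableOn_compact isCompact_Icc)]
  exact (ae_restrict_iff' measurableSet_Icc).2 (ae_of_all _ hf0)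

/-- A double counting estimate for the lengths of two intervals, in terms of the sections of
a relation `S` between them. -/
lemma length_le_of_sections {a b a' b' ρ M C : ℝ} (hab' : a' ≤ b') (hρ : 0 < ρ)
    (hM : 0 ≤ M) (hC : 0 ≤ C) {f g : ℝ → ℝ}
    (hf : ContinuousOn f (Icc a b)) (hf0 : ∀ t ∈ Icc a b, 0 ≤ f t)
    (hg : ContinuousOn g (Icc a' b')) (hg0 : ∀ s ∈ Icc a' b', 0 ≤ g s)
    {S : Set (ℝ × ℝ)} (hS : MeasurableSet S)
    (hfg : ∀ t ∈ Icc a b, ∀ s ∈ Icc a' b', (t, s) ∈ S → g s ≤ C * f t)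
    (hlow : ∀ t ∈ Icc a b, ∃ s₁ s₂, a' ≤ s₁ ∧ s₁ ≤ s₂ ∧ s₂ ≤ b' ∧
      (∀ s ∈ Icc s₁ s₂, (t, s) ∈ S) ∧ ρ ≤ ∫ s in s₁..s₂, g s)
    (hup : ∀ s ∈ Icc a' b', ∃ t₁ t₂, a ≤ t₁ ∧ t₁ ≤ t₂ ∧ t₂ ≤ b ∧
      (∀ t ∈ Icc a b, (t, s) ∈ S → t ∈ Icc t₁ t₂) ∧ ∫ t in t₁..t₂, f t ≤ M) :
    b - a ≤ M / ρ * C * (b' - a') := by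
  set F : ℝ → ℝ → ENNReal := fun t s => S.indicator (fun p => ENNReal.ofReal (f p.1)) (t, s)
  have hlow' : ∀ t ∈ Icc a b,
      ENNReal.ofReal ρ ≤ ENNReal.ofReal C * ∫⁻ s in Icc a' b', F t s := by
    intro t ht
    obtain ⟨s₁, s₂, h1, h12, h2, hs, hint⟩ := hlow t ht
    have hsub : Icc s₁ s₂ ⊆ Icc a' b' := Icc_subset_Icc h1 h2
    calc ENNReal.ofReal ρ ≤ ∫⁻ s in Icc s₁ s₂, ENNReal.ofReal (g s) := by
          rw [lintegral_Icc_eq_ofReal h12 (hg.mono hsub) fun s h => hg0 s (hsub h)]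
          exact ENNReal.ofReal_le_ofReal hint
      _ ≤ ∫⁻ s in Icc s₁ s₂, ENNReal.ofReal C * F t s := by
          refine setLIntegral_mono' measurableSet_Icc fun s h => ?_
          simp only [F, indicator_of_mem (hs s h)]
          rw [← ENNReal.ofReal_mul hC]
          exact ENNReal.ofReal_le_ofReal (hfg t ht s (hsub h) (hs s h))
      _ = ENNReal.ofReal C * ∫⁻ s in Icc s₁ s₂, F t s :=
          lintegral_const_mul' _ _ ENNReal.ofReal_ne_top
      _ ≤ _ := by gcongr
  have hup' : ∀ s ∈ Icc a' b', ∫⁻ t in Icc a b, F t s ≤ ENNReal.ofReal M := by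
    intro s hs
    obtain ⟨t₁, t₂, h1, h12, h2, ht, hint⟩ := hup s hs
    have hsub : Icc t₁ t₂ ⊆ Icc a b := Icc_subset_Icc h1 h2
    calc ∫⁻ t in Icc a b, F t s
        ≤ ∫⁻ t in Icc a b, (Icc t₁ t₂).indicator (fun t => ENNReal.ofReal (f t)) t := by
          refine setLIntegral_mono' measurableSet_Icc fun t h => ?_
          by_cases hts : (t, s) ∈ S
          · simp only [F, indicator_of_mem hts, indicator_of_mem (ht t h hts), le_refl]
          · simp only [F, indicator_of_notMem hts, zero_le]
      _ ≤ ∫⁻ t in Icc t₁ t₂, ENNReal.ofReal (f t) :=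
          (setLIntegral_le_lintegral _ _).trans (lintegral_indicator measurableSet_Icc _).le
      _ ≤ _ := by
          rw [lintegral_Icc_eq_ofReal h12 (hf.mono hsub) fun t h => hf0 t (hsub h)]
          exact ENNReal.ofReal_le_ofReal hint
  have hmeas : AEMeasurable (Function.uncurry F)
      ((volume.restrict (Icc a b)).prod (volume.restrict (Icc a' b'))) := by
    refine AEMeasurable.indicator ?_ hS
    exact ((hf.aemeasurable measurableSet_Icc).comp_fst).ennreal_ofReal
  have key : ENNReal.ofReal ρ * ENNReal.ofReal (b - a) ≤
      ENNReal.ofReal C * (ENNReal.ofReal M * ENNReal.ofReal (b' - a')) := by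
    calc ENNReal.ofReal ρ * ENNReal.ofReal (b - a) = ∫⁻ t in Icc a b, ENNReal.ofReal ρ := by
          rw [setLIntegral_const, Real.volume_Icc]
      _ ≤ ∫⁻ t in Icc a b, ENNReal.ofReal C * ∫⁻ s in Icc a' b', F t s :=
          setLIntegral_mono' measurableSet_Icc hlow'
      _ = ENNReal.ofReal C * ∫⁻ s in Icc a' b', ∫⁻ t in Icc a b, F t s := by
          rw [lintegral_const_mul' _ _ ENNReal.ofReal_ne_top, lintegral_lintegral_swap hmeas]
      _ ≤ ENNReal.ofReal C * ∫⁻ s in Icc a' b', ENNReal.ofReal M :=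
          mul_le_mul_right (setLIntegral_mono' measurableSet_Icc hup') _
      _ = _ := by rw [setLIntegral_const, Real.volume_Icc]
  rw [← ENNReal.ofReal_mul hρ.le, ← ENNReal.ofReal_mul hM, ← ENNReal.ofReal_mul hC,
    ENNReal.ofReal_le_ofReal_iff (mul_nonneg hC (mul_nonneg hM (sub_nonneg.2 hab')))] at key
  rw [div_mul_eq_mul_div, div_mul_eq_mul_div, le_div_iff₀ hρ]
  linarith

variable {D : Set E} {γ ϑ : ℝ → E} {a b a' b' : ℝ}

lemma IsArc.continuousOn_qhLen (hD : IsProperDomain D) (h : IsArc D γ a b) :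
    ContinuousOn (fun t => qhLen D γ a t) (Icc a b) := by
  have h' := intervalIntegral.continuousOn_primitive_interval (μ := volume)
    (f := fun t => 1 / dB D (γ t)) (a := a) (b := b)
  rw [uIcc_of_le h.le] at h'
  exact h' ((h.continuousOn_density hD).integrableOn_compact isCompact_Icc)

lemma IsArc.qhLen_sub (hD : IsProperDomain D) (h : IsArc D γ a b) {s t : ℝ} (hs : s ∈ Icc a b)
    (ht : t ∈ Icc a b) (hst : s ≤ t) : qhLen D γ s t = qhLen D γ a t - qhLen D γ a s := by
  linarith [(h.mono le_rfl ht.1 ht.2).qhLen_add hD (c := s) ⟨hs.1, hst⟩]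

lemma IsArc.qhLen_mono (hD : IsProperDomain D) (h : IsArc D γ a b) {s t : ℝ} (hs : s ∈ Icc a b)
    (ht : t ∈ Icc a b) (hst : s ≤ t) : qhLen D γ a s ≤ qhLen D γ a t := by
  linarith [h.qhLen_sub hD hs ht hst, qhLen_nonneg D γ hst]

lemma IsArc.qhDist_le_abs (hD : IsProperDomain D) (h : IsArc D γ a b) {s t : ℝ}
    (hs : s ∈ Icc a b) (ht : t ∈ Icc a b) :
    qhDist D (γ s) (γ t) ≤ |qhLen D γ a s - qhLen D γ a t| := by
  wlog hst : s ≤ t generalizing s t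
  · rw [(h.arcJoined_of_mem hs ht).qhDist_comm, abs_sub_comm]
    exact this ht hs (le_of_not_ge hst)
  · rw [abs_sub_comm, ← h.qhLen_sub hD hs ht hst]
    exact (h.mono hs.1 hst ht.2).qhDist_le.trans (le_abs_self _)

lemma IsArc.qhLen_pos (hD : IsProperDomain D) (h : IsArc D γ a b) (hab : a < b) :
    0 < qhLen D γ a b :=
  intervalIntegral.intervalIntegral_pos_of_pos_on (h.intervalIntegrable hD)
    (fun t ht => one_div_pos.2 (dB_pos hD (h.mem t (Ioo_subset_Icc_self ht)))) hab

lemma IsArc.exists_subarc (hD : IsProperDomain D) (h : IsArc D γ a b) {s₀ r : ℝ}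
    (hs₀ : s₀ ∈ Icc a b) (hr : 0 ≤ r) : ∃ s₁ s₂, a ≤ s₁ ∧ s₁ ≤ s₂ ∧ s₂ ≤ b ∧
      (∀ s ∈ Icc s₁ s₂, qhDist D (γ s₀) (γ s) ≤ r) ∧
      min r (qhLen D γ a b) ≤ qhLen D γ s₁ s₂ := by
  have ha := left_mem_Icc.2 h.le
  have hb := right_mem_Icc.2 h.le
  have hc := h.continuousOn_qhLen hD
  have h0 : qhLen D γ a a = 0 := by simp [qhLen]
  have m1 := h.qhLen_mono hD ha hs₀ hs₀.1
  have m2 := h.qhLen_mono hD hs₀ hb hs₀.2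
  obtain ⟨s₁, hs₁, e₁⟩ := intermediate_value_Icc hs₀.1
    (hc.mono (Icc_subset_Icc le_rfl hs₀.2))
    (show max (qhLen D γ a s₀ - r) 0 ∈ Icc _ _ from
      ⟨h0 ▸ le_max_right _ _, max_le (by linarith) (by linarith)⟩)
  obtain ⟨s₂, hs₂, e₂⟩ := intermediate_value_Icc hs₀.2
    (hc.mono (Icc_subset_Icc hs₀.1 le_rfl))
    (show min (qhLen D γ a s₀ + r) (qhLen D γ a b) ∈ Icc _ _ from
      ⟨le_min (by linarith) m2, min_le_right _ _⟩)
  have hs₁' : s₁ ∈ Icc a b := ⟨hs₁.1, hs₁.2.trans hs₀.2⟩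
  have hs₂' : s₂ ∈ Icc a b := ⟨hs₀.1.trans hs₂.1, hs₂.2⟩
  refine ⟨s₁, s₂, hs₁.1, hs₁.2.trans hs₂.1, hs₂.2, fun s hs => ?_, ?_⟩
  · have hs' : s ∈ Icc a b := ⟨hs₁.1.trans hs.1, hs.2.trans hs₂.2⟩
    refine (h.qhDist_le_abs hD hs₀ hs').trans (abs_sub_le_iff.2 ⟨?_, ?_⟩)
    · have := h.qhLen_mono hD hs₁' hs' hs.1
      simp only at e₁
      linarith [le_max_left (qhLen D γ a s₀ - r) 0]
    · have := h.qhLen_mono hD hs' hs₂' hs.2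
      simp only at e₂
      linarith [min_le_left (qhLen D γ a s₀ + r) (qhLen D γ a b)]
  · simp only at e₁ e₂
    rw [h.qhLen_sub hD hs₁' hs₂' (hs₁.2.trans hs₂.1), e₁, e₂]
    rcases max_cases (qhLen D γ a s₀ - r) 0 with ⟨p, -⟩ | ⟨p, -⟩ <;>
    rcases min_cases (qhLen D γ a s₀ + r) (qhLen D γ a b) with ⟨q, -⟩ | ⟨q, -⟩ <;>
    rw [p, q] <;>
    first
      | (refine (min_le_left _ _).trans ?_; linarith)
      | (refine (min_le_right _ _).trans ?_; linarith)

/-- If a quasigeodesic stays within quasihyperbolic distance `μ` of a second arc with the same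
endpoints, then its length is controlled by that of the second arc. -/
lemma IsQuasigeodesicOn.length_le_of_near (hD : IsProperDomain D) {c μ r : ℝ} (hc : 1 ≤ c)
    (hμ : 0 ≤ μ) (hr : 0 < r) (hϑ : IsQuasigeodesicOn D c ϑ a b)
    (hγ : IsArc D γ a' b') (h1 : ϑ a = γ a') (h2 : ϑ b = γ b')
    (hnear : ∀ t ∈ Icc a b, ∃ s ∈ Icc a' b', qhDist D (ϑ t) (γ s) ≤ μ) :
    b - a ≤ 2 * c * (1 + μ / r) * Real.exp (μ + r) * (b' - a') := by
  have hab := hϑ.1.le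
  have hab' := hγ.le
  have ha := left_mem_Icc.2 hab
  have hb := right_mem_Icc.2 hab
  have ha' := left_mem_Icc.2 hab'
  have hlen : qhLen D ϑ a b ≤ c * qhLen D γ a' b' := by
    refine (hϑ.2 a b ha hb hab).trans ?_
    rw [h1, h2]
    exact mul_le_mul_of_nonneg_left hγ.qhDist_le (by linarith)
  rcases hab.eq_or_lt with rfl | hlt
  · rw [sub_self]
    have := sub_nonneg.2 hab'
    positivity
  have hK : 0 < qhLen D γ a' b' := by
    have := hϑ.1.qhLen_pos hD hlt
    by_contra! hneg
    nlinarith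
  have hj : ∀ t ∈ Icc a b, ∀ s ∈ Icc a' b', ArcJoined D (ϑ t) (γ s) := fun t ht s hs =>
    ((hϑ.1.arcJoined_of_mem ht ha).trans hD (h1 ▸ hγ.arcJoined_of_mem ha' hs))
  set S : Set (ℝ × ℝ) := {p | p ∈ Icc a b ×ˢ Icc a' b' ∧ qhDist D (ϑ p.1) (γ p.2) ≤ μ + r}
  have hcont : ContinuousOn (fun p : ℝ × ℝ => qhDist D (ϑ p.1) (γ p.2))
      (Icc a b ×ˢ Icc a' b') := by
    rintro ⟨t₀, s₀⟩ ⟨ht₀, hs₀⟩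
    refine tendsto_iff_dist_tendsto_zero.2 ?_
    have hϑc : ContinuousOn (fun p : ℝ × ℝ => qhLen D ϑ a p.1) (Icc a b ×ˢ Icc a' b') :=
      (hϑ.1.continuousOn_qhLen hD).comp continuousOn_fst fun p hp => hp.1
    have hγc : ContinuousOn (fun p : ℝ × ℝ => qhLen D γ a' p.2) (Icc a b ×ˢ Icc a' b') :=
      (hγ.continuousOn_qhLen hD).comp continuousOn_snd fun p hp => hp.2
    have hlim := (tendsto_iff_dist_tendsto_zero.1 (hϑc (t₀, s₀) ⟨ht₀, hs₀⟩)).add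
      (tendsto_iff_dist_tendsto_zero.1 (hγc (t₀, s₀) ⟨ht₀, hs₀⟩))
    rw [add_zero] at hlim
    refine squeeze_zero' (.of_forall fun _ => dist_nonneg) ?_ hlim
    filter_upwards [self_mem_nhdsWithin]
    rintro ⟨t, s⟩ ⟨ht, hs⟩
    have key : ∀ t ∈ Icc a b, ∀ s ∈ Icc a' b', ∀ t' ∈ Icc a b, ∀ s' ∈ Icc a' b',
        qhDist D (ϑ t) (γ s) - qhDist D (ϑ t') (γ s') ≤
        |qhLen D ϑ a t - qhLen D ϑ a t'| + |qhLen D γ a' s - qhLen D γ a' s'| := by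
      intro t ht s hs t' ht' s' hs'
      have j1 := hϑ.1.arcJoined_of_mem ht ht'
      have j2 := hγ.arcJoined_of_mem hs' hs
      have k1 := qhDist_triangle hD j1 (hj t' ht' s hs)
      have k2 := qhDist_triangle hD (hj t' ht' s' hs') j2
      have k3 := hϑ.1.qhDist_le_abs hD ht ht'
      have k4 := hγ.qhDist_le_abs hD hs' hs
      rw [abs_sub_comm] at k4
      linarith
    simp only [Real.dist_eq]
    refine abs_sub_le_iff.2 ⟨key t ht s hs t₀ ht₀ s₀ hs₀, ?_⟩
    rw [abs_sub_comm (qhLen D ϑ a t), abs_sub_comm (qhLen D γ a' s)]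
    exact key t₀ ht₀ s₀ hs₀ t ht s hs
  have hSc : IsClosed S :=
    hcont.preimage_isClosed_of_isClosed (isClosed_Icc.prod isClosed_Icc) isClosed_Iic
  have hρ : 0 < min r (qhLen D γ a' b') := lt_min hr hK
  have hM : 0 ≤ c * min (2 * (μ + r)) (qhLen D γ a' b') := by positivity
  have hmain := length_le_of_sections hab' hρ hM (Real.exp_pos (μ + r)).le
    (hϑ.1.continuousOn_density hD)
    (fun t ht => (one_div_pos.2 (dB_pos hD (hϑ.1.mem t ht))).le)
    (hγ.continuousOn_density hD)
    (fun t ht => (one_div_pos.2 (dB_pos hD (hγ.mem t ht))).le)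
    hSc.measurableSet ?_ ?_ ?_
  · have hratio : c * min (2 * (μ + r)) (qhLen D γ a' b') / min r (qhLen D γ a' b') ≤
        2 * c * (1 + μ / r) := by
      rw [div_le_iff₀ hρ]
      have e : 2 * c * (1 + μ / r) = c * (2 * (μ + r)) / r := by field_simp; ring
      rcases min_cases r (qhLen D γ a' b') with ⟨p, -⟩ | ⟨p, -⟩ <;> rw [p]
      · rw [e, div_mul_cancel₀ _ hr.ne']
        exact mul_le_mul_of_nonneg_left (min_le_left _ _) (by linarith)
      · have h3 : 0 ≤ μ / r := by positivity
        have h4 := min_le_right (2 * (μ + r)) (qhLen D γ a' b')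
        calc c * min (2 * (μ + r)) (qhLen D γ a' b') ≤ c * qhLen D γ a' b' := by gcongr
          _ ≤ 2 * c * (1 + μ / r) * qhLen D γ a' b' := by
            gcongr
            nlinarith
    refine hmain.trans ?_
    have := sub_nonneg.2 hab'
    gcongr
  · rintro t ht s hs ⟨-, hd⟩
    have h3 := (hj t ht s hs).symm.dB_le hD
    rw [← (hj t ht s hs).qhDist_comm] at h3
    have h4 := dB_pos hD (hϑ.1.mem t ht)
    have h5 := dB_pos hD (hγ.mem s hs)
    rw [mul_one_div, div_le_div_iff₀ h5 h4, one_mul, mul_comm]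
    refine h3.trans ?_
    gcongr
  · intro t ht
    obtain ⟨s₀, hs₀, hd⟩ := hnear t ht
    obtain ⟨s₁, s₂, g1, g12, g2, hs, hl⟩ := hγ.exists_subarc hD hs₀ hr.le
    refine ⟨s₁, s₂, g1, g12, g2, fun s hs' => ?_, hl⟩
    have hsI : s ∈ Icc a' b' := ⟨g1.trans hs'.1, hs'.2.trans g2⟩
    refine ⟨⟨ht, hsI⟩, ?_⟩
    have := qhDist_triangle hD (hj t ht s₀ hs₀) (hγ.arcJoined_of_mem hs₀ hsI)
    simp only
    linarith [hs s hs']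
  · intro s hs
    set A : Set ℝ := {t | (t, s) ∈ S}
    have hAsub : A ⊆ Icc a b := fun t ht => ht.1.1
    have hAc : IsCompact A :=
      isCompact_Icc.of_isClosed_subset (hSc.preimage (by fun_prop)) hAsub
    rcases A.eq_empty_or_nonempty with hA | hA
    · refine ⟨a, a, le_rfl, le_rfl, hab, fun t _ ht => ?_, by simpa using hM⟩
      exact absurd (show t ∈ A from ht) (by simp [hA])
    · obtain ⟨t₁, ht₁, hmin⟩ := hAc.exists_isLeast hA
      obtain ⟨t₂, ht₂, hmax⟩ := hAc.exists_isGreatest hA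
      have h12 := hmin ht₂
      have i1 := hAsub ht₁
      have i2 := hAsub ht₂
      refine ⟨t₁, t₂, i1.1, h12, i2.2, fun t _ ht => ⟨hmin ht, hmax ht⟩, ?_⟩
      change qhLen D ϑ t₁ t₂ ≤ _
      rw [mul_min_of_nonneg _ _ (by linarith)]
      refine le_min ?_ ?_
      · refine (hϑ.2 t₁ t₂ i1 i2 h12).trans (mul_le_mul_of_nonneg_left ?_ (by linarith))
        have k := qhDist_triangle hD (hj t₁ i1 s hs) (hj t₂ i2 s hs).symm
        rw [← (hj t₂ i2 s hs).qhDist_comm] at k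
        have k1 : qhDist D (ϑ t₁) (γ s) ≤ μ + r := ht₁.2
        have k2 : qhDist D (ϑ t₂) (γ s) ≤ μ + r := ht₂.2
        linarith
      · refine le_trans ?_ hlen
        rw [hϑ.1.qhLen_sub hD i1 i2 h12]
        have e0 : qhLen D ϑ a a = 0 := by simp [qhLen]
        linarith [hϑ.1.qhLen_mono hD ha i1 i1.1, hϑ.1.qhLen_mono hD i2 hb i2.2]

end Comparison

section Segments

lemma eVariationOn_eq_of_edist_eq {X Y : Type*} [PseudoEMetricSpace X] [PseudoEMetricSpace Y]
    {f : ℝ → X} {g : ℝ → Y} (h : ∀ s t, edist (f s) (f t) = edist (g s) (g t)) (A : Set ℝ) :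
    eVariationOn f A = eVariationOn g A := by
  simp only [eVariationOn, h]

variable {D : Set E} {γ : ℝ → E} {a b : ℝ} {x y : E}

lemma mem_of_norm_sub_lt (h : ‖x - y‖ < dB D x) : y ∈ D := by
  by_contra hy
  have := Metric.infDist_le_dist_of_mem (x := x) (show y ∈ Dᶜ from hy)
  rw [dist_eq_norm] at this
  exact absurd h (not_lt.2 this)

lemma IsQuasigeodesicOn.mono_const {c c' : ℝ} (h : IsQuasigeodesicOn D c γ a b) (hc : c ≤ c') :
    IsQuasigeodesicOn D c' γ a b :=
  ⟨h.1, fun s t hs ht hst => (h.2 s t hs ht hst).trans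
    (mul_le_mul_of_nonneg_right hc (qhDist_nonneg _ _ _))⟩

lemma IsQuasigeodesicOn.injOn (hD : IsProperDomain D) {c : ℝ} (h : IsQuasigeodesicOn D c γ a b) :
    InjOn γ (Icc a b) := by
  intro s hs t ht hst
  wlog hlt : s ≤ t generalizing s t
  · exact (this ht hs hst.symm (le_of_not_ge hlt)).symm
  rcases hlt.eq_or_lt with heq | hlt'
  · exact heq
  have h1 := (h.1.mono hs.1 hlt ht.2).qhLen_pos hD hlt'
  have h2 := h.2 s t hs ht hlt
  rw [← hst, qhDist_self (h.1.mem s hs), mul_zero] at h2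
  linarith

variable [NormedSpace ℝ E]

/-- Segments deep inside `D` are `3/2`-quasigeodesics. -/
lemma exists_quasigeodesic_segment (hD : IsProperDomain D) (hx : x ∈ D) {p q : E}
    (hp : ‖x - p‖ ≤ dB D x / 10) (hq : ‖x - q‖ ≤ dB D x / 10) :
    ∃ (σ : ℝ → E) (T : ℝ), IsQuasigeodesicOn D (3 / 2) σ 0 T ∧ σ 0 = p ∧ σ T = q ∧
      σ '' Icc 0 T = segment ℝ p q := by
  have hd := dB_pos hD hx
  have hpD : p ∈ D := mem_of_norm_sub_lt (hp.trans_lt (by linarith))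
  rcases eq_or_ne p q with rfl | hpq
  · exact ⟨fun _ => p, 0, isQuasigeodesicOn_const (by norm_num) hpD 0, rfl, rfl, by simp⟩
  have hT : 0 < ‖q - p‖ := norm_pos_iff.2 (sub_ne_zero.2 hpq.symm)
  set T := ‖q - p‖ with hTdef
  set σ : ℝ → E := fun t => p + (t / T) • (q - p) with hσ
  have hnorm : ∀ s t, ‖σ s - σ t‖ = |s - t| := by
    intro s t
    have : σ s - σ t = ((s - t) / T) • (q - p) := by simp only [hσ]; module
    rw [this, norm_smul, ← hTdef, Real.norm_eq_abs, abs_div, abs_of_pos hT,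
      div_mul_cancel₀ _ hT.ne']
  have himage : σ '' Icc 0 T = segment ℝ p q := by
    rw [segment_eq_image']
    ext z
    constructor
    · rintro ⟨t, ht, rfl⟩
      exact ⟨t / T, ⟨div_nonneg ht.1 hT.le, (div_le_one hT).2 ht.2⟩, rfl⟩
    · rintro ⟨θ, hθ, rfl⟩
      refine ⟨θ * T, ⟨mul_nonneg hθ.1 hT.le, mul_le_of_le_one_left hT.le hθ.2⟩, ?_⟩
      simp only [hσ, mul_div_cancel_right₀ _ hT.ne']
  have hball : ∀ t ∈ Icc 0 T, ‖x - σ t‖ ≤ dB D x / 10 := by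
    intro t ht
    have h1 : σ t ∈ segment ℝ p q := himage ▸ mem_image_of_mem σ ht
    have h2 := (convex_closedBall x (dB D x / 10)).segment_subset
      (by rwa [mem_closedBall', dist_eq_norm]) (by rwa [mem_closedBall', dist_eq_norm]) h1
    rwa [mem_closedBall', dist_eq_norm] at h2
  have hmem : ∀ t ∈ Icc 0 T, σ t ∈ D := fun t ht =>
    mem_of_norm_sub_lt ((hball t ht).trans_lt (by linarith))
  have hlow : ∀ t ∈ Icc 0 T, 9 / 10 * dB D x ≤ dB D (σ t) := fun t ht => by
    have h1 := dB_le_add_norm D (σ t) x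
    rw [norm_sub_rev] at h1
    linarith [hball t ht]
  have hupp : ∀ t ∈ Icc 0 T, dB D (σ t) ≤ 11 / 10 * dB D x := fun t ht => by
    linarith [hball t ht, dB_le_add_norm D x (σ t)]
  have harc : IsArc D σ 0 T := by
    refine .of_hasUnitSpeedOn hT.le ?_ hmem
    refine hasConstantSpeedOnWith_iff_ordered.2 fun s hs t ht hst => ?_
    rw [inter_eq_self_of_subset_right (Icc_subset_Icc hs.1 ht.2)]
    rw [eVariationOn_eq_of_edist_eq (g := fun u : ℝ => u) fun u v => by
      rw [edist_dist, edist_dist, dist_eq_norm, hnorm, Real.dist_eq]]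
    have := (monotone_id.monotoneOn (Icc s t)).eVariationOn_eq
      (left_mem_Icc.2 hst) (right_mem_Icc.2 hst)
    simpa [Function.id_def] using this
  refine ⟨σ, T, ⟨harc, fun s t hs ht hst => ?_⟩, by simp [hσ], by simp [hσ, hT.ne'], himage⟩
  have hupper : qhLen D σ s t ≤ (t - s) * (10 / (9 * dB D x)) := by
    have h1 : qhLen D σ s t ≤ ∫ _ in s..t, 10 / (9 * dB D x) := by
      refine intervalIntegral.integral_mono_on hst
        ((harc.mono hs.1 hst ht.2).intervalIntegrable hD) (by simp) fun u hu => ?_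
      have hu' : u ∈ Icc 0 T := ⟨hs.1.trans hu.1, hu.2.trans ht.2⟩
      rw [div_le_div_iff₀ (dB_pos hD (hmem u hu')) (by positivity)]
      linarith [hlow u hu']
    simpa [mul_div_assoc] using h1
  have hk := ((harc.mono hs.1 hst ht.2).arcJoined).dB_add_le hD
  rw [hnorm, abs_sub_comm, abs_of_nonneg (sub_nonneg.2 hst)] at hk
  set k := qhDist D (σ s) (σ t)
  have hk0 : 0 ≤ k := qhDist_nonneg _ _ _
  have hks : 0 < dB D (σ s) := dB_pos hD (hmem s hs)
  have hlen : t - s ≤ 2 / 10 * dB D x := by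
    have h1 := norm_sub_le_norm_sub_add_norm_sub p x q
    rw [norm_sub_rev p x, norm_sub_rev p q] at h1
    linarith [hs.1, ht.2]
  have hk1 : t - s ≤ k * (13 / 10 * dB D x) := by
    have h1 := Real.one_sub_le_exp_neg k
    have h2 : (dB D (σ s) + (t - s)) * Real.exp (-k) ≤ dB D (σ s) := by
      refine (mul_le_mul_of_nonneg_right hk (Real.exp_pos _).le).trans ?_
      rw [mul_assoc, ← Real.exp_add, add_neg_cancel, Real.exp_zero, mul_one]
    have h3 : (dB D (σ s) + (t - s)) * (1 - k) ≤ (dB D (σ s) + (t - s)) * Real.exp (-k) :=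
      mul_le_mul_of_nonneg_left h1 (by linarith)
    have h4 : t - s ≤ k * (dB D (σ s) + (t - s)) := by linarith
    refine h4.trans (mul_le_mul_of_nonneg_left ?_ hk0)
    linarith [hupp s hs]
  refine hupper.trans ?_
  rw [mul_div_assoc', div_le_iff₀ (by positivity)]
  nlinarith [mul_nonneg hk0 hd.le]

/-- If the ambient space has dimension at least two, triangles cannot be too thin. -/
lemma ThinTriangles.le_exp (hD : IsProperDomain D) (hx : x ∈ D) {c μ : ℝ} (hc : 3 / 2 ≤ c)
    (hthin : ThinTriangles D c μ) {f : StrongDual ℝ E} {u v : E} (hf : ‖f‖ ≤ 1)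
    (hu : ‖u‖ = 1) (hv : ‖v‖ = 1) (hfu : f u = 1) (hfv : f v = 0) : 31 / 30 ≤ Real.exp μ := by
  have hd := dB_pos hD hx
  set d := dB D x with hd_def
  set r := d / 10 with hr_def
  have hr : 0 < r := by positivity
  have key : ∀ α β : ℝ, |α| + |β| = 1 → 1 / 3 ≤ ‖α • u + β • v‖ := by
    intro α β hαβ
    have h1 : |α| ≤ ‖α • u + β • v‖ := by
      have := f.le_of_opNorm_le hf (α • u + β • v)
      simpa [hfu, hfv] using this
    have h2 : |β| ≤ ‖α • u + β • v‖ + |α| := by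
      have := norm_sub_le (α • u + β • v) (α • u)
      simpa [norm_smul, hu, hv] using this
    linarith
  have hp : ‖x - (x - r • u)‖ ≤ d / 10 := by
    simp [norm_smul, hu, abs_of_pos hd, hr_def]
  have hq : ‖x - (x + r • u)‖ ≤ d / 10 := by
    simp [norm_smul, hu, abs_of_pos hd, hr_def]
  have hw : ‖x - (x + r • v)‖ ≤ d / 10 := by
    simp [norm_smul, hv, abs_of_pos hd, hr_def]
  have far : ∀ y, ∀ α β : ℝ, |α| + |β| = 1 → y - x = r • (α • u + β • v) →
      ‖x - y‖ ≤ d / 10 → qhDist D x y ≤ μ → 31 / 30 ≤ Real.exp μ := by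
    intro y α β hαβ he hy hk
    obtain ⟨σ, T, hσ, h0, hT, -⟩ := exists_quasigeodesic_segment hD hx
      (p := x) (q := y) (by simpa using (hr.le)) hy
    have hj : ArcJoined D x y := by rw [← h0, ← hT]; exact hσ.1.arcJoined
    have h1 := hj.dB_add_le hD
    rw [norm_sub_rev, he, norm_smul, Real.norm_eq_abs, abs_of_pos hr, ← hd_def] at h1
    have h2 := mul_le_mul_of_nonneg_left (key α β hαβ) hr.le
    have h3 : d * Real.exp (qhDist D x y) ≤ d * Real.exp μ := by gcongr
    have h4 : d * (31 / 30) ≤ d * Real.exp μ := by linarith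
    exact le_of_mul_le_mul_left h4 hd
  obtain ⟨σ₁, T₁, g₁, i₁, e₁, m₁⟩ := exists_quasigeodesic_segment hD hx hp hq
  obtain ⟨σ₂, T₂, g₂, i₂, e₂, m₂⟩ := exists_quasigeodesic_segment hD hx hq hw
  obtain ⟨σ₃, T₃, g₃, i₃, e₃, m₃⟩ := exists_quasigeodesic_segment hD hx hw hp
  have hxm : x ∈ σ₁ '' Icc 0 T₁ := by
    rw [m₁, segment_eq_image']
    exact ⟨1 / 2, by norm_num, by module⟩
  have hball : ∀ p q y : E, ‖x - p‖ ≤ d / 10 → ‖x - q‖ ≤ d / 10 → y ∈ segment ℝ p q →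
      ‖x - y‖ ≤ d / 10 := by
    intro p q y hp hq hy
    have h2 := (convex_closedBall x (d / 10)).segment_subset
      (by rwa [mem_closedBall', dist_eq_norm]) (by rwa [mem_closedBall', dist_eq_norm]) hy
    rwa [mem_closedBall', dist_eq_norm] at h2
  obtain ⟨t, ht, hxt⟩ := hxm
  obtain ⟨s, ⟨hs, hk⟩ | ⟨hs, hk⟩⟩ := hthin σ₁ σ₂ σ₃ 0 T₁ 0 T₂ 0 T₃ (g₁.mono_const hc)
    (g₂.mono_const hc) (g₃.mono_const hc) (e₁.trans i₂.symm) (e₂.trans i₃.symm)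
    (e₃.trans i₁.symm) t ht
  · have hy : σ₂ s ∈ segment ℝ (x + r • u) (x + r • v) := m₂ ▸ mem_image_of_mem _ hs
    have hy' := hball _ _ _ hq hw hy
    rw [hxt] at hk
    rw [segment_eq_image'] at hy
    obtain ⟨θ, hθ, hθe⟩ := hy
    refine far _ (1 - θ) θ ?_ ?_ hy' hk
    · rw [abs_of_nonneg (by linarith [hθ.2]), abs_of_nonneg hθ.1]
      ring
    · rw [← hθe]
      module
  · have hy : σ₃ s ∈ segment ℝ (x + r • v) (x - r • u) := m₃ ▸ mem_image_of_mem _ hs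
    have hy' := hball _ _ _ hw hp hy
    rw [hxt] at hk
    rw [segment_eq_image'] at hy
    obtain ⟨θ, hθ, hθe⟩ := hy
    refine far _ (-θ) (1 - θ) ?_ ?_ hy' hk
    · rw [abs_neg, abs_of_nonneg (by linarith [hθ.2] : (0 : ℝ) ≤ 1 - θ), abs_of_nonneg hθ.1]
      ring
    · rw [← hθe]
      module

/-- In a one-dimensional space, quasigeodesics are segments. -/
lemma IsQuasigeodesicOn.length_le_norm (hD : IsProperDomain D) {c : ℝ}
    (h : IsQuasigeodesicOn D c γ a b) {f : StrongDual ℝ E} (hf : ∀ v, |f v| = ‖v‖) :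
    b - a ≤ ‖γ a - γ b‖ := by
  have hab := h.1.le
  have ha := left_mem_Icc.2 hab
  have hb := right_mem_Icc.2 hab
  have main : ∀ g : StrongDual ℝ E, (∀ v, |g v| = ‖v‖) → MonotoneOn (fun t => g (γ t)) (Icc a b) →
      b - a ≤ ‖γ a - γ b‖ := by
    intro g hg hmono
    have h1 := hmono.eVariationOn_eq ha hb
    rw [inter_self, ← eVariationOn_eq_of_edist_eq (f := γ) fun s t => by
      rw [edist_dist, edist_dist, dist_eq_norm, Real.dist_eq, ← map_sub, hg],
      h.1.unit a b ha hb hab, ENNReal.ofReal_eq_ofReal_iff (sub_nonneg.2 hab)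
      (sub_nonneg.2 (hmono ha hb hab)), ← map_sub] at h1
    rw [norm_sub_rev, ← hg]
    exact h1.trans_le (le_abs_self _)
  have hinj : InjOn (fun t => f (γ t)) (Icc a b) := by
    intro s hs t ht hst
    refine h.injOn hD hs ht (sub_eq_zero.1 (norm_eq_zero.1 ?_))
    rw [← hf, map_sub]
    simpa [sub_eq_zero] using hst
  rcases ContinuousOn.strictMonoOn_of_injOn_Icc' hab
    (f.continuous.comp_continuousOn h.1.continuousOn) hinj with hm | hm
  · exact main f hf hm.monotoneOn
  · refine main (-f) (by simpa using hf) fun s hs t ht hst => ?_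
    simpa using hm.antitoneOn hs ht hst

end Segments

/-- One-sided length comparison for quasigeodesics with common endpoints. -/
lemma IsQuasigeodesicOn.length_le_exp_mul [NormedSpace ℝ E] {D : Set E} (hD : IsProperDomain D)
    {c μ : ℝ} (hc : 1 ≤ c) (hμ : 0 ≤ μ) (hthin : ThinTriangles D c μ) {ϑ γ : ℝ → E}
    {a b a' b' : ℝ} (hϑ : IsQuasigeodesicOn D c ϑ a b) (hγ : IsQuasigeodesicOn D c γ a' b')
    (h1 : ϑ a = γ a') (h2 : ϑ b = γ b') :
    b - a ≤ 4 * Real.exp (8 * c ^ 2 * μ) * (b' - a') := by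
  have hx : ϑ a ∈ D := hϑ.1.mem a (left_mem_Icc.2 hϑ.1.le)
  have hlen : 0 ≤ b' - a' := sub_nonneg.2 hγ.1.le
  obtain ⟨w, hw⟩ := hD.2.2
  have hne : ϑ a - w ≠ 0 := fun h => hw (sub_eq_zero.1 h ▸ hx)
  obtain ⟨f, hf, hfw⟩ := exists_dual_vector ℝ _ (norm_ne_zero_iff.2 hne)
  have hwpos := norm_pos_iff.2 hne
  set u : E := ‖ϑ a - w‖⁻¹ • (ϑ a - w)
  have hu : ‖u‖ = 1 := norm_smul_inv_norm hne
  have hfu : f u = 1 := by simp [u, hfw, hwpos.ne']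
  by_cases hdim : ∀ v, f v = 0 → v = 0
  · have hiso : ∀ v, |f v| = ‖v‖ := by
      intro v
      have h3 : v = f v • u := sub_eq_zero.1 (hdim _ (by simp [hfu]))
      conv_rhs => rw [h3, norm_smul, hu, mul_one, Real.norm_eq_abs]
    have h3 := hϑ.length_le_norm hD hiso
    rw [h1, h2] at h3
    have h4 : (1 : ℝ) ≤ Real.exp (8 * c ^ 2 * μ) := Real.one_le_exp (by positivity)
    nlinarith [hγ.1.norm_sub_le]
  have hcase : c ≤ 3 / 2 ∨ 1 / 31 ≤ μ := by
    by_contra! hcon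
    push Not at hdim
    obtain ⟨v, hfv, hv⟩ := hdim
    have h3 := hthin.le_exp hD hx hcon.1.le hf.le hu (norm_smul_inv_norm hv) hfu
      (show f ((‖v‖ : ℝ)⁻¹ • v) = 0 by simp [hfv])
    have h4 : Real.exp μ * Real.exp (-μ) = 1 := by rw [← Real.exp_add]; simp
    nlinarith [Real.one_sub_le_exp_neg μ, Real.exp_pos (-μ)]
  have hnear := fun t ht => hthin.exists_near (by linarith) hϑ hγ h1 h2 (t := t) ht
  rcases hμ.eq_or_lt with rfl | hμ'
  · have hc' : c ≤ 3 / 2 := hcase.resolve_right (by norm_num)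
    have h3 := hϑ.length_le_of_near hD hc le_rfl (r := 1 / 4) (by norm_num) hγ.1 h1 h2 hnear
    have h4 : Real.exp (1 / 4) ≤ 4 / 3 := by
      have h5 : Real.exp (1 / 4) * Real.exp (-(1 / 4)) = 1 := by rw [← Real.exp_add]; simp
      nlinarith [Real.one_sub_le_exp_neg (1 / 4), Real.exp_pos (1 / 4)]
    refine h3.trans (mul_le_mul_of_nonneg_right ?_ hlen)
    rw [zero_div, add_zero, mul_one, zero_add, mul_zero, Real.exp_zero]
    nlinarith
  · have h3 := hϑ.length_le_of_near hD hc hμ (r := 3 * μ) (by positivity) hγ.1 h1 h2 hnear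
    refine h3.trans (mul_le_mul_of_nonneg_right ?_ hlen)
    have h4 : μ / (3 * μ) = 1 / 3 := by field_simp
    have h5 : 8 * c ^ 2 * μ = (8 * c ^ 2 - 4) * μ + (μ + 3 * μ) := by ring
    rw [h4, h5, Real.exp_add _ (μ + 3 * μ), ← mul_assoc]
    refine mul_le_mul_of_nonneg_right ?_ (Real.exp_pos _).le
    have h6 := Real.add_one_le_exp ((8 * c ^ 2 - 4) * μ)
    have h7 : 0 ≤ 8 * c ^ 2 - 4 := by nlinarith
    rcases hcase with hc' | hμ''
    · nlinarith [mul_nonneg h7 hμ]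
    · nlinarith [mul_le_mul_of_nonneg_left hμ'' h7, sq_nonneg (c - 31 / 24)]

/-- In a `δ`-Gromov hyperbolic domain, the lengths of two
`c₀`-quasigeodesics with the same endpoints are comparable, with comparison
constant `4 e^{8 c₀² μ₂}`, where `μ₂` is the thin-triangles constant for
`c₀`-quasigeodesics. -/
theorem stmt9 [NormedSpace ℝ E] [CompleteSpace E]
    (D : Set E) (hD : IsProperDomain D) (δ c₀ μ₂ : ℝ)
    (hδ : 0 < δ) (hc₀ : 1 ≤ c₀) (hμ₂ : 0 ≤ μ₂)
    (hhyp : IsGromovHyp D δ) (hthin : ThinTriangles D c₀ μ₂)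
    (x₁ x₂ : E) (hx₁ : x₁ ∈ D) (hx₂ : x₂ ∈ D)
    (ϑ : ℝ → E) (a b : ℝ) (hϑ : IsQuasigeodesicOn D c₀ ϑ a b)
    (hϑ₁ : ϑ a = x₁) (hϑ₂ : ϑ b = x₂)
    (γ : ℝ → E) (a' b' : ℝ) (hγ : IsQuasigeodesicOn D c₀ γ a' b')
    (hγ₁ : γ a' = x₁) (hγ₂ : γ b' = x₂) :
    max (b - a) (b' - a') ≤
      4 * Real.exp (8 * c₀ ^ 2 * μ₂) * min (b - a) (b' - a') := by
  have h₁ : ϑ a = γ a' := hϑ₁.trans hγ₁.symm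
  have h₂ : ϑ b = γ b' := hϑ₂.trans hγ₂.symm
  have hle := hϑ.length_le_exp_mul hD hc₀ hμ₂ hthin hγ h₁ h₂
  have hle' := hγ.length_le_exp_mul hD hc₀ hμ₂ hthin hϑ h₁.symm h₂.symm
  have hC : 1 ≤ 4 * Real.exp (8 * c₀ ^ 2 * μ₂) := by
    linarith [Real.one_le_exp (show 0 ≤ 8 * c₀ ^ 2 * μ₂ by positivity)]
  have hab := sub_nonneg.2 hϑ.1.le
  have hab' := sub_nonneg.2 hγ.1.le
  rw [mul_min_of_nonneg _ _ (by linarith)]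
  exact max_le (le_min (le_mul_of_one_le_left hab hC) hle)
    (le_min hle' (le_mul_of_one_le_left hab' hC))

end
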